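/- Let R be a Noetherian ℤ^r-graded commutative ring, M a finitely generated ℤ^r-graded R-module, and 𝔭 a ℤ^r-graded prime ideal in the support of M. Then there exists a chain 𝔭_0 ⊂ 𝔭_1 ⊂ ⋯ ⊂ 𝔭_d = 𝔭 of ℤ^r-graded prime ideals in the support of M, where d = dim M_𝔭 (the Krull dimension of the localized module M_𝔭 over R_𝔭). -/

import Mathlib

/-- Membership of a prime (or any ideal) `q` in the support of `M`: the localization
of `M` at the multiplicative set generated by the complement of `q` is nonzero. -/
def memSupport {R : Type*} [CommRing R] (M : Type*) [AddCommGroup M] [Module R M]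
    (q : Ideal R) : Prop :=
  Nontrivial (LocalizedModule (Submonoid.closure ((q : Set R)ᶜ)) M)

/-- The Krull dimension of `M_𝔭` (for finitely generated `M` this is the dimension of
`R_𝔭/Ann(M_𝔭)`): the Krull dimension of the poset of primes `q ⊆ 𝔭` lying in the
support of `M`. -/
noncomputable def supportDimAt {R : Type*} [CommRing R] (M : Type*) [AddCommGroup M]
    [Module R M] (p : Ideal R) : WithBot ℕ∞ :=
  Order.krullDim {q : PrimeSpectrum R // q.asIdeal ≤ p ∧ memSupport M q.asIdeal}

open DirectSum in
/-- The annihilator of a graded module is a homogeneous ideal. -/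
theorem Module.annihilator_isHomogeneous {ι σ τ R M : Type*} [AddRightCancelMonoid ι]
    [DecidableEq ι] [CommRing R] [AddCommGroup M] [Module R M]
    [SetLike σ R] [AddSubmonoidClass σ R] (𝒜 : ι → σ) [GradedRing 𝒜]
    [SetLike τ M] [AddSubmonoidClass τ M] (ℳ : ι → τ) [Decomposition ℳ]
    [SetLike.GradedSMul 𝒜 ℳ] : (Module.annihilator R M).IsHomogeneous 𝒜 := by
  intro g a ha
  rw [Module.mem_annihilator] at ha ⊢
  intro m
  induction m using Decomposition.inductionOn ℳ with
  | zero => exact smul_zero _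
  | add m n hm hn => rw [smul_add, hm, hn, add_zero]
  | @homogeneous h m =>
    have key (b : R) :
        ((decompose ℳ (b • (m : M)) (g + h) : ℳ (g + h)) : M) =
          ((decompose 𝒜 b g : 𝒜 g) : R) • (m : M) := by
      induction b using Decomposition.inductionOn 𝒜 with
      | zero => simp
      | add b c hb hc => simp [add_smul, hb, hc]
      | @homogeneous i b =>
        have hmem : (b : R) • (m : M) ∈ ℳ (i + h) := SetLike.GradedSMul.smul_mem b.2 m.2
        by_cases hi : i = g
        · subst hi
          rw [decompose_of_mem_same ℳ hmem, decompose_of_mem_same 𝒜 b.2]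
        · rw [decompose_of_mem_ne ℳ hmem (fun e => hi (add_right_cancel e)),
            decompose_of_mem_ne 𝒜 b.2 hi, zero_smul]
    rw [← key, ha, decompose_zero, DirectSum.zero_apply, ZeroMemClass.coe_zero]

section LinearOrder

variable {ι σ R : Type*} [CommRing R] [IsNoetherianRing R]
  [AddCommMonoid ι] [LinearOrder ι] [IsOrderedCancelAddMonoid ι]
  [SetLike σ R] [AddSubmonoidClass σ R] {𝒜 : ι → σ} [GradedRing 𝒜]

/-- A chain of primes above a homogeneous ideal that ends in a homogeneous prime can be replaced
by a chain of homogeneous primes of the same length with the same end. -/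
theorem PrimeSpectrum.exists_homogeneous_ltSeries {I : Ideal R} (hI : I.IsHomogeneous 𝒜)
    (l : LTSeries (PrimeSpectrum R)) (hhead : I ≤ l.head.asIdeal)
    (hlast : l.last.asIdeal.IsHomogeneous 𝒜) :
    ∃ l' : LTSeries (PrimeSpectrum R), l'.length = l.length ∧ l'.last = l.last ∧
      I ≤ l'.head.asIdeal ∧ ∀ q ∈ l', q.asIdeal.IsHomogeneous 𝒜 := by
  induction hn : l.length generalizing I l with
  | zero =>
    have hl : l.head = l.last := by
      rw [RelSeries.head, RelSeries.last]
      congr 1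
      ext
      simp [hn]
    refine ⟨RelSeries.singleton _ l.last, rfl, rfl, hl ▸ hhead, fun q hq => ?_⟩
    obtain ⟨i, rfl⟩ := hq
    exact hlast
  | succ n ih =>
    let q₀ : PrimeSpectrum R :=
      ⟨(l.head.asIdeal.homogeneousCore 𝒜).toIdeal, l.head.isPrime.homogeneousCore⟩
    have hq₀ : q₀.asIdeal.IsHomogeneous 𝒜 := (l.head.asIdeal.homogeneousCore 𝒜).isHomogeneous
    have hIq₀ : I ≤ q₀.asIdeal := by
      rw [← hI.toIdeal_homogeneousCore_eq_self]
      exact Ideal.homogeneousCore_mono 𝒜 hhead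
    have hq₀_le : q₀ ≤ l.head := Ideal.toIdeal_homogeneousCore_le 𝒜 l.head.asIdeal
    have hne : l.length ≠ 0 := by omega
    have hlt : q₀ < (l.tail hne).head := by
      rw [RelSeries.head_tail]
      refine hq₀_le.trans_lt (l.strictMono ?_)
      rw [Fin.lt_def, Fin.val_one', Nat.mod_eq_of_lt (by omega)]
      exact Nat.zero_lt_one
    have hlt_last : q₀ < l.last := by
      refine hq₀_le.trans_lt (l.strictMono ?_)
      rw [Fin.lt_def]
      simpa using Nat.pos_of_ne_zero hne
    obtain ⟨a, ha, ha_last, ha₀⟩ :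
        ∃ a : R, SetLike.IsHomogeneousElem 𝒜 a ∧ a ∈ l.last.asIdeal ∧ a ∉ q₀.asIdeal := by
      obtain ⟨x, hx, hx₀⟩ := SetLike.exists_of_lt (show q₀.asIdeal < l.last.asIdeal from hlt_last)
      rw [hq₀.mem_iff] at hx₀
      push Not at hx₀
      obtain ⟨g, hg⟩ := hx₀
      exact ⟨_, ⟨g, SetLike.coe_mem _⟩, hlast g hx, hg⟩
    obtain ⟨l₂, ha₂, hlen₂, hhead₂, hlast₂⟩ :=
      PrimeSpectrum.exist_ltSeries_mem_one_of_mem_last ((l.tail hne).cons q₀ hlt)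
        (x := a) (by simpa using ha_last)
    have hlen₂' : l₂.length = n + 1 := by
      rw [← hlen₂]
      simp [hn]
    rw [RelSeries.head_cons] at hhead₂
    rw [RelSeries.last_cons, RelSeries.last_tail] at hlast₂
    have hne₂ : l₂.length ≠ 0 := by omega
    obtain ⟨l₃, hlen₃, hlast₃, hhead₃, hhom₃⟩ := ih
      (hq₀.sup (Ideal.homogeneous_span 𝒜 {a} (by simpa using ha))) (l₂.tail hne₂)
      (by
        rw [RelSeries.head_tail]
        refine sup_le ?_ ((Ideal.span_singleton_le_iff_mem _).mpr ha₂)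
        rw [hhead₂]
        exact l₂.monotone (Fin.zero_le 1))
      (by rwa [RelSeries.last_tail, ← hlast₂])
      (by simp [hlen₂'])
    have hlt₃ : q₀ < l₃.head := by
      refine lt_of_le_of_ne (le_sup_left.trans hhead₃) fun h => ha₀ ?_
      rw [h]
      exact hhead₃ (Ideal.mem_sup_right (Ideal.mem_span_singleton_self a))
    refine ⟨l₃.cons q₀ hlt₃, by simp [hlen₃], ?_, ?_, fun q hq => ?_⟩
    · rw [RelSeries.last_cons, hlast₃, RelSeries.last_tail, hlast₂]
    · rwa [RelSeries.head_cons]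
    · rw [← RelSeries.mem_toList, RelSeries.toList_cons, List.mem_cons,
        RelSeries.mem_toList] at hq
      rcases hq with rfl | hq
      exacts [hq₀, hhom₃ q hq]

end LinearOrder

/-- A version of `PrimeSpectrum.exists_homogeneous_ltSeries` for a grading monoid that admits a
compatible linear order, with an arbitrary choice of decidable equality. -/
theorem PrimeSpectrum.exists_homogeneous_ltSeries_of_orderable {ι σ R : Type*} [CommRing R]
    [IsNoetherianRing R] [AddCommMonoid ι] [dec : DecidableEq ι]
    (hι : ∃ _ : LinearOrder ι, IsOrderedCancelAddMonoid ι)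
    [SetLike σ R] [AddSubmonoidClass σ R] (𝒜 : ι → σ) [GradedRing 𝒜]
    {I : Ideal R} (hI : I.IsHomogeneous 𝒜)
    (l : LTSeries (PrimeSpectrum R)) (hhead : I ≤ l.head.asIdeal)
    (hlast : l.last.asIdeal.IsHomogeneous 𝒜) :
    ∃ l' : LTSeries (PrimeSpectrum R), l'.length = l.length ∧ l'.last = l.last ∧
      I ≤ l'.head.asIdeal ∧ ∀ q ∈ l', q.asIdeal.IsHomogeneous 𝒜 := by
  obtain ⟨lo, _⟩ := hι
  obtain rfl : dec = lo.toDecidableEq := Subsingleton.elim _ _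
  exact PrimeSpectrum.exists_homogeneous_ltSeries hI l hhead hlast

/-- The lexicographic order makes `ℤ^r` a linearly ordered group. -/
theorem exists_linearOrder_isOrderedCancelAddMonoid_pi_int (r : ℕ) :
    ∃ lo : LinearOrder (Fin r → ℤ),
      @IsOrderedCancelAddMonoid (Fin r → ℤ) _ lo.toPartialOrder.toPreorder :=
  ⟨(Pi.Lex.linearOrder : LinearOrder (Lex (Fin r → ℤ))),
    (inferInstance : IsOrderedCancelAddMonoid (Lex (Fin r → ℤ)))⟩

/-- For a prime ideal, `memSupport` is membership in `Module.support`, that is, for a finite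
module, containment of the annihilator. -/
theorem memSupport_iff_annihilator_le {R M : Type*} [CommRing R] [AddCommGroup M] [Module R M]
    [Module.Finite R M] (q : PrimeSpectrum R) :
    memSupport M q.asIdeal ↔ Module.annihilator R M ≤ q.asIdeal := by
  rw [← Module.mem_support_iff_of_finite, Module.mem_support_iff, memSupport,
    show Submonoid.closure ((q.asIdeal : Set R)ᶜ) = q.asIdeal.primeCompl from
      Submonoid.closure_eq q.asIdeal.primeCompl]

/-- In a Noetherian ℤ^r-graded ring `R`, given a finite ℤ^r-graded module `M` and a
ℤ^r-graded prime `𝔭` in the support of `M`, there is a chain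
`𝔭₀ ⊂ 𝔭₁ ⊂ ⋯ ⊂ 𝔭_d = 𝔭`, `d = dim M_𝔭`, of ℤ^r-graded primes in the support of `M`. -/
theorem exists_graded_prime_chain_in_support
    {r : ℕ} {R M : Type*} [CommRing R] [IsNoetherianRing R]
    [AddCommGroup M] [Module R M] [Module.Finite R M]
    (𝒜 : (Fin r → ℤ) → AddSubgroup R) [GradedRing 𝒜]
    (ℳ : (Fin r → ℤ) → AddSubgroup M) [DirectSum.Decomposition ℳ]
    [SetLike.GradedSMul 𝒜 ℳ]
    (p : Ideal R) (hp : p.IsPrime)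
    (hgraded : ∀ a ∈ p, ∀ g : Fin r → ℤ, (↑(DirectSum.decompose 𝒜 a g) : R) ∈ p)
    (hsupp : memSupport M p)
    (d : ℕ) (hd : supportDimAt M p = (d : ℕ∞)) :
    ∃ c : Fin (d + 1) → Ideal R, StrictMono c ∧ c (Fin.last d) = p ∧
      ∀ i : Fin (d + 1), (c i).IsPrime ∧
        (∀ a ∈ c i, ∀ g : Fin r → ℤ, (↑(DirectSum.decompose 𝒜 a g) : R) ∈ c i) ∧
        memSupport M (c i) := by
  have hp_top : IsTop (α := {q : PrimeSpectrum R // q.asIdeal ≤ p ∧ memSupport M q.asIdeal})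
      ⟨⟨p, hp⟩, le_rfl, hsupp⟩ := fun q => q.2.1
  obtain ⟨l, hlen⟩ := Order.le_krullDim_iff.mp (show ((d : ℕ) : WithBot ℕ∞) ≤
    Order.krullDim {q : PrimeSpectrum R // q.asIdeal ≤ p ∧ memSupport M q.asIdeal} from hd.ge)
  have hl_last : l.last = ⟨⟨p, hp⟩, le_rfl, hsupp⟩ := by
    by_contra hne
    have h := Order.LTSeries.length_le_krullDim (l.snoc _ (lt_of_le_of_ne (hp_top l.last) hne))
    rw [show Order.krullDim _ = ((d : ℕ∞) : WithBot ℕ∞) from hd] at h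
    simp only [RelSeries.snoc_length, hlen] at h
    norm_cast at h
    omega
  have hmap_last : (l.map Subtype.val fun _ _ h => h : LTSeries (PrimeSpectrum R)).last =
      ⟨p, hp⟩ := congrArg Subtype.val hl_last
  obtain ⟨c, hc_len, hc_last, hc_head, hc_hom⟩ :=
    PrimeSpectrum.exists_homogeneous_ltSeries_of_orderable
      (exists_linearOrder_isOrderedCancelAddMonoid_pi_int r) 𝒜
      (Module.annihilator_isHomogeneous 𝒜 ℳ) (l.map Subtype.val fun _ _ h => h)
      ((memSupport_iff_annihilator_le _).mp l.head.2.2)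
      (by
        rw [hmap_last]
        exact fun g a ha => hgraded a ha g)
  obtain rfl : c.length = d := hc_len.trans hlen
  refine ⟨fun i => (c i).asIdeal, fun i j h => c.strictMono h, ?_, fun i =>
    ⟨(c i).isPrime, fun a ha g => hc_hom (c i) ⟨i, rfl⟩ g ha,
      (memSupport_iff_annihilator_le _).mpr (hc_head.trans (c.monotone (Fin.zero_le i)))⟩⟩
  exact congrArg PrimeSpectrum.asIdeal (hc_last.trans hmap_last)
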